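/- arXiv:1602.02020 — 2 statements merged into one kernel-verified Lean document; each statement's English description precedes it below -/
import Mathlib

section
/- Evolution of the deviations from the ensemble mean: along any solution of the continuous-time EnKF flow with y = A u†, the deviations e^{(j)}(t) = u^{(j)}(t) − ū(t) satisfy de^{(j)}/dt = −(1/J) Σ_{k=1}^J E_{jk}(t) e^{(k)}(t) = −(1/J) Σ_{k=1}^J E_{jk}(t) r^{(k)}(t) for every j = 1,…,J. -/
open scoped BigOperators
open RealInnerProductSpace Matrix

noncomputable section

/-- The Γ-weighted inner product `⟨a,b⟩_Γ = ⟨Γ⁻¹ a, b⟩` on `ℝ^K`. -/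
def gInner {K : ℕ} (Γ : Matrix (Fin K) (Fin K) ℝ)
    (a b : EuclideanSpace ℝ (Fin K)) : ℝ :=
  ⟪Matrix.toEuclideanLin Γ⁻¹ a, b⟫

/-- Ensemble mean. -/
def ensMean {X : Type*} [AddCommGroup X] [Module ℝ X] {J : ℕ} (v : Fin J → X) : X :=
  (J : ℝ)⁻¹ • ∑ j, v j

/-- Right-hand side of the continuous-time EnKF flow. -/
def enkfRHS {X : Type*} [NormedAddCommGroup X] [InnerProductSpace ℝ X] {K J : ℕ}
    (A : X →L[ℝ] EuclideanSpace ℝ (Fin K)) (Γ : Matrix (Fin K) (Fin K) ℝ)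
    (y : EuclideanSpace ℝ (Fin K)) (v : Fin J → X) (j : Fin J) : X :=
  (J : ℝ)⁻¹ • ∑ k, gInner Γ (A (v k - ensMean v)) (y - A (v j)) • (v k - ensMean v)

/-- `u : ℝ → Fin J → X` solves the continuous-time EnKF flow on `[0,∞)`. -/
def IsEnKFSolution {X : Type*} [NormedAddCommGroup X] [InnerProductSpace ℝ X] {K J : ℕ}
    (A : X →L[ℝ] EuclideanSpace ℝ (Fin K)) (Γ : Matrix (Fin K) (Fin K) ℝ)
    (y : EuclideanSpace ℝ (Fin K)) (u : ℝ → Fin J → X) : Prop :=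
  ∀ j : Fin J, ∀ t ∈ Set.Ici (0 : ℝ),
    HasDerivWithinAt (fun s => u s j) (enkfRHS A Γ y (u t) j) (Set.Ici 0) t

/-- The deviation Gram matrix `E` of an ensemble. -/
def matE {X : Type*} [NormedAddCommGroup X] [InnerProductSpace ℝ X] {K J : ℕ}
    (A : X →L[ℝ] EuclideanSpace ℝ (Fin K)) (Γ : Matrix (Fin K) (Fin K) ℝ)
    (v : Fin J → X) : Matrix (Fin J) (Fin J) ℝ :=
  Matrix.of fun l j => gInner Γ (A (v l - ensMean v)) (A (v j - ensMean v))

/-- The residual/deviation cross Gram matrix `F` of an ensemble. -/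
def matF {X : Type*} [NormedAddCommGroup X] [InnerProductSpace ℝ X] {K J : ℕ}
    (A : X →L[ℝ] EuclideanSpace ℝ (Fin K)) (Γ : Matrix (Fin K) (Fin K) ℝ)
    (udag : X) (v : Fin J → X) : Matrix (Fin J) (Fin J) ℝ :=
  Matrix.of fun l j => gInner Γ (A (v l - udag)) (A (v j - ensMean v))

/-- The residual Gram matrix `R` of an ensemble. -/
def matR {X : Type*} [NormedAddCommGroup X] [InnerProductSpace ℝ X] {K J : ℕ}
    (A : X →L[ℝ] EuclideanSpace ℝ (Fin K)) (Γ : Matrix (Fin K) (Fin K) ℝ)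
    (udag : X) (v : Fin J → X) : Matrix (Fin J) (Fin J) ℝ :=
  Matrix.of fun l j => gInner Γ (A (v l - udag)) (A (v j - udag))

/-- The orthogonal complement of a subspace of `ℝ^K` w.r.t. the Γ-weighted inner product. -/
def gOrth {K : ℕ} (Γ : Matrix (Fin K) (Fin K) ℝ)
    (S : Submodule ℝ (EuclideanSpace ℝ (Fin K))) :
    Submodule ℝ (EuclideanSpace ℝ (Fin K)) where
  carrier := {w | ∀ v ∈ S, gInner Γ v w = 0}
  add_mem' := by
    intro a b ha hb v hv
    have h1 := ha v hv
    have h2 := hb v hv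
    simp only [gInner, Set.mem_setOf_eq] at *
    rw [inner_add_right, h1, h2, add_zero]
  zero_mem' := by
    intro v hv
    simp [gInner]
  smul_mem' := by
    intro c a ha v hv
    have h1 := ha v hv
    simp only [gInner, Set.mem_setOf_eq] at *
    rw [inner_smul_right, h1, mul_zero]

/-- The orthogonal complement of a subspace of `X` w.r.t. the inner product
`⟨v,w⟩_* = ⟨A v, A w⟩_Γ`. -/
def gOrthX {X : Type*} [NormedAddCommGroup X] [InnerProductSpace ℝ X] {K : ℕ}
    (A : X →L[ℝ] EuclideanSpace ℝ (Fin K)) (Γ : Matrix (Fin K) (Fin K) ℝ)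
    (S : Submodule ℝ X) : Submodule ℝ X where
  carrier := {w | ∀ v ∈ S, gInner Γ (A v) (A w) = 0}
  add_mem' := by
    intro a b ha hb v hv
    have h1 := ha v hv
    have h2 := hb v hv
    simp only [gInner, Set.mem_setOf_eq, map_add] at *
    rw [inner_add_right, h1, h2, add_zero]
  zero_mem' := by
    intro v hv
    simp [gInner]
  smul_mem' := by
    intro c a ha v hv
    have h1 := ha v hv
    simp only [gInner, Set.mem_setOf_eq, _root_.map_smul] at *
    rw [inner_smul_right, h1, mul_zero]


theorem gInner_symm' {K : ℕ} {Γ : Matrix (Fin K) (Fin K) ℝ} (hΓ : Γ.PosDef)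
    (a b : EuclideanSpace ℝ (Fin K)) : gInner Γ a b = gInner Γ b a := by
  have h : (Matrix.toEuclideanLin Γ⁻¹).IsSymmetric :=
    Matrix.isSymmetric_toEuclideanLin_iff.mpr hΓ.inv.isHermitian
  unfold gInner
  rw [h a b, real_inner_comm]

theorem sum_dev {X : Type*} [AddCommGroup X] [Module ℝ X] {J : ℕ} (hJ : 0 < J)
    (v : Fin J → X) : ∑ k, (v k - ensMean v) = 0 := by
  have hJ' : (J : ℝ) ≠ 0 := by positivity
  rw [Finset.sum_sub_distrib, Finset.sum_const, Finset.card_univ, Fintype.card_fin, ensMean,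
    ← Nat.cast_smul_eq_nsmul ℝ, smul_smul, mul_inv_cancel₀ hJ', one_smul, sub_self]

theorem mean_rhs {X : Type*} [NormedAddCommGroup X] [InnerProductSpace ℝ X] {K J : ℕ}
    (hJ : 0 < J) (A : X →L[ℝ] EuclideanSpace ℝ (Fin K)) (Γ : Matrix (Fin K) (Fin K) ℝ)
    (y : EuclideanSpace ℝ (Fin K)) (v : Fin J → X) :
    ensMean (fun j => enkfRHS A Γ y v j) = (J : ℝ)⁻¹ •
      ∑ k, gInner Γ (A (v k - ensMean v)) (y - A (ensMean v)) • (v k - ensMean v) := by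
  have hJ' : (J : ℝ) ≠ 0 := by positivity
  conv_lhs => unfold ensMean
  simp only [enkfRHS]
  rw [← Finset.smul_sum, Finset.sum_comm]
  congr 1
  rw [Finset.smul_sum]
  refine Finset.sum_congr rfl fun k _ => ?_
  rw [← Finset.sum_smul, smul_smul]
  congr 1
  unfold gInner
  rw [← inner_sum, ← inner_smul_right (𝕜 := ℝ)]
  congr 1
  rw [Finset.sum_sub_distrib, Finset.sum_const, Finset.card_univ, Fintype.card_fin, smul_sub,
    ← Nat.cast_smul_eq_nsmul ℝ, smul_smul, inv_mul_cancel₀ hJ', one_smul, ensMean,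
    _root_.map_smul, map_sum]

theorem enkf_deviation_evolution
    {X : Type*} [NormedAddCommGroup X] [InnerProductSpace ℝ X]
    {K J : ℕ} (hJ : 0 < J)
    (A : X →L[ℝ] EuclideanSpace ℝ (Fin K))
    (Γ : Matrix (Fin K) (Fin K) ℝ) (hΓ : Γ.PosDef)
    (udag : X) (u : ℝ → Fin J → X)
    (hu : IsEnKFSolution A Γ (A udag) u) :
    ∀ j : Fin J, ∀ t ∈ Set.Ici (0 : ℝ),
      HasDerivWithinAt (fun s => u s j - ensMean (u s))
        (-((J : ℝ)⁻¹ • ∑ k, matE A Γ (u t) j k • (u t k - ensMean (u t))))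
        (Set.Ici 0) t ∧
      -((J : ℝ)⁻¹ • ∑ k, matE A Γ (u t) j k • (u t k - ensMean (u t))) =
        -((J : ℝ)⁻¹ • ∑ k, matE A Γ (u t) j k • (u t k - udag)) := by
  intro j t ht
  constructor
  · have hm : HasDerivWithinAt (fun s => ensMean (u s))
        (ensMean (fun j => enkfRHS A Γ (A udag) (u t) j)) (Set.Ici 0) t := by
      unfold ensMean
      exact (HasDerivWithinAt.fun_sum fun i _ => hu i t ht).const_smul _
    have h := (hu j t ht).sub hm
    refine h.congr_deriv ?_
    rw [mean_rhs hJ, enkfRHS, ← smul_sub, ← smul_neg, ← Finset.sum_sub_distrib,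
      ← Finset.sum_neg_distrib]
    congr 1
    refine Finset.sum_congr rfl fun k _ => ?_
    rw [← sub_smul, ← neg_smul]
    congr 1
    simp only [matE, Matrix.of_apply]
    rw [gInner_symm' hΓ (A (u t j - ensMean (u t)))]
    unfold gInner
    rw [← inner_sub_right, ← inner_neg_right]
    congr 1
    rw [map_sub]
    abel
  · congr 2
    rw [← sub_eq_zero, ← Finset.sum_sub_distrib]
    simp only [← smul_sub, sub_sub_sub_cancel_left]
    rw [← Finset.sum_smul]
    have : ∑ k, matE A Γ (u t) j k = 0 := by
      simp only [matE, Matrix.of_apply, gInner]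
      rw [← inner_sum, ← map_sum, sum_dev hJ, map_zero, inner_zero_right]
    rw [this, zero_smul]

end
end

section
/- Evolution of the cross Gram matrix: along any solution of the continuous-time EnKF flow with y = A u†, the J×J matrix F(t) with entries F(t)_{lj} = ⟨A r^{(l)}(t), A e^{(j)}(t)⟩_Γ satisfies the matrix differential equation dF/dt = −(2/J) F E, where E(t)_{lj} = ⟨A e^{(l)}(t), A e^{(j)}(t)⟩_Γ. -/
open scoped BigOperators
open RealInnerProductSpace Matrix

noncomputable section

theorem gInner_symm_aux {K : ℕ} (Γ : Matrix (Fin K) (Fin K) ℝ) (hΓ : Γ.PosDef)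
    (a b : EuclideanSpace ℝ (Fin K)) : gInner Γ a b = gInner Γ b a := by
  have hs : (Matrix.toEuclideanLin Γ⁻¹).IsSymmetric :=
    Matrix.isSymmetric_toEuclideanLin_iff.mpr hΓ.isHermitian.inv
  unfold gInner
  rw [hs a b, real_inner_comm]

/-- The EnKF covariance operator. -/
def enkfT {X : Type*} [NormedAddCommGroup X] [InnerProductSpace ℝ X] {K J : ℕ}
    (A : X →L[ℝ] EuclideanSpace ℝ (Fin K)) (Γ : Matrix (Fin K) (Fin K) ℝ)
    (e : Fin J → X) : X →L[ℝ] X :=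
  (J : ℝ)⁻¹ • ∑ k, ((innerSL ℝ (Matrix.toEuclideanLin Γ⁻¹ (A (e k)))).comp A).smulRight (e k)

theorem enkfT_apply {X : Type*} [NormedAddCommGroup X] [InnerProductSpace ℝ X] {K J : ℕ}
    (A : X →L[ℝ] EuclideanSpace ℝ (Fin K)) (Γ : Matrix (Fin K) (Fin K) ℝ)
    (e : Fin J → X) (x : X) :
    enkfT A Γ e x = (J : ℝ)⁻¹ • ∑ k, gInner Γ (A (e k)) (A x) • e k := by
  simp [enkfT, gInner, ContinuousLinearMap.sum_apply]

theorem enkfRHS_eq {X : Type*} [NormedAddCommGroup X] [InnerProductSpace ℝ X] {K J : ℕ}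
    (A : X →L[ℝ] EuclideanSpace ℝ (Fin K)) (Γ : Matrix (Fin K) (Fin K) ℝ)
    (udag : X) (v : Fin J → X) (j : Fin J) :
    enkfRHS A Γ (A udag) v j = enkfT A Γ (fun k => v k - ensMean v) (udag - v j) := by
  rw [enkfT_apply, enkfRHS, map_sub]

theorem ensMean_enkfRHS {X : Type*} [NormedAddCommGroup X] [InnerProductSpace ℝ X] {K J : ℕ}
    (hJ : 0 < J)
    (A : X →L[ℝ] EuclideanSpace ℝ (Fin K)) (Γ : Matrix (Fin K) (Fin K) ℝ)
    (udag : X) (v : Fin J → X) :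
    ensMean (fun j => enkfRHS A Γ (A udag) v j)
      = enkfT A Γ (fun k => v k - ensMean v) (udag - ensMean v) := by
  have hJ' : (J : ℝ) ≠ 0 := by positivity
  simp only [enkfRHS_eq]
  generalize enkfT A Γ (fun k => v k - ensMean v) = T
  unfold ensMean
  rw [← map_sum, ← map_smul, Finset.sum_sub_distrib, smul_sub]
  congr 2
  rw [Finset.sum_const, Finset.card_univ, Fintype.card_fin, ← Nat.cast_smul_eq_nsmul ℝ, smul_smul,
    inv_mul_cancel₀ hJ', one_smul]

theorem enkf_cross_gram_evolution
    {X : Type*} [NormedAddCommGroup X] [InnerProductSpace ℝ X]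
    {K J : ℕ} (hJ : 0 < J)
    (A : X →L[ℝ] EuclideanSpace ℝ (Fin K))
    (Γ : Matrix (Fin K) (Fin K) ℝ) (hΓ : Γ.PosDef)
    (udag : X) (u : ℝ → Fin J → X)
    (hu : IsEnKFSolution A Γ (A udag) u) :
    ∀ t ∈ Set.Ici (0 : ℝ), ∀ l j : Fin J,
      HasDerivWithinAt (fun s => matF A Γ udag (u s) l j)
        ((-(2 / (J : ℝ))) * (matF A Γ udag (u t) * matE A Γ (u t)) l j)
        (Set.Ici 0) t := by
  intro t ht l j
  have hmean : HasDerivWithinAt (fun s => ensMean (u s))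
      (ensMean (fun j => enkfRHS A Γ (A udag) (u t) j)) (Set.Ici 0) t := by
    unfold ensMean
    exact (HasDerivWithinAt.fun_sum (fun i _ => hu i t ht)).const_smul _
  have he := (hu j t ht).sub hmean
  rw [ensMean_enkfRHS hJ, enkfRHS_eq, ← map_sub, sub_sub_sub_cancel_left] at he
  have hr := (hu l t ht).sub_const udag
  rw [enkfRHS_eq] at hr
  have hAe := A.hasFDerivAt.comp_hasDerivWithinAt t he
  have hAr := (LinearMap.toContinuousLinearMap
    (Matrix.toEuclideanLin Γ⁻¹)).hasFDerivAt.comp_hasDerivWithinAt t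
      (A.hasFDerivAt.comp_hasDerivWithinAt t hr)
  have hF := hAr.inner ℝ hAe
  refine hF.congr_deriv ?_
  have e1 : ∀ x z : X, gInner Γ (A x) (A (enkfT A Γ (fun k => u t k - ensMean (u t)) z))
      = (J : ℝ)⁻¹ * ∑ k, gInner Γ (A (u t k - ensMean (u t))) (A z)
          * gInner Γ (A x) (A (u t k - ensMean (u t))) := by
    intro x z
    rw [enkfT_apply, map_smul, map_sum]
    simp only [gInner, map_smul, inner_smul_right, inner_sum]
  change gInner Γ (A (u t l - udag)) (A (enkfT A Γ (fun k => u t k - ensMean (u t))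
      (ensMean (u t) - u t j)))
    + gInner Γ (A (enkfT A Γ (fun k => u t k - ensMean (u t)) (udag - u t l)))
      (A (u t j - ensMean (u t))) = _
  have hneg : ∀ a b c : X, gInner Γ (A a) (A (b - c)) = - gInner Γ (A a) (A (c - b)) := by
    intro a b c
    rw [← neg_sub c b, map_neg, gInner, inner_neg_right, gInner]
  rw [gInner_symm_aux Γ hΓ (A (enkfT _ _ _ _)), e1, e1, Matrix.mul_apply, ← mul_add,
    ← Finset.sum_add_distrib, Finset.mul_sum, Finset.mul_sum]
  refine Finset.sum_congr rfl fun k _ => ?_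
  rw [hneg _ (ensMean (u t)) (u t j), hneg _ udag (u t l)]
  simp only [matF, matE, Matrix.of_apply]
  rw [gInner_symm_aux Γ hΓ (A (u t k - ensMean (u t))) (A (u t l - udag)),
    gInner_symm_aux Γ hΓ (A (u t j - ensMean (u t))) (A (u t k - ensMean (u t)))]
  ring

end
end
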